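/- arXiv:2206.02869 — 5 statements merged into one kernel-verified Lean document; each statement's English description precedes it below -/
import Mathlib

section
/- Let X ⊆ ℙⁿ be a nonempty closed subset (in the quotient of the Euclidean topology). Then the closure in ℙ^{n+1} of the set S = {[u : x] ∈ ℙ^{n+1} : u ∈ ℂ, [x] ∈ X} is exactly S ∪ {[1 : 0 : ⋯ : 0]}; in particular, this union is a closed subset of ℙ^{n+1}. -/
open MvPolynomial

noncomputable section

namespace UGen

/-- The (quotient of the Euclidean) topology on the projectivization of `ℂ^N`. -/
instance {N : ℕ} : TopologicalSpace (Projectivization ℂ (Fin N → ℂ)) :=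
  inferInstanceAs (TopologicalSpace (Quotient (projectivizationSetoid ℂ (Fin N → ℂ))))

lemma cons_ne_zero {N : ℕ} (u : ℂ) {x : Fin N → ℂ} (hx : x ≠ 0) :
    (Fin.cons u x : Fin (N + 1) → ℂ) ≠ 0 := by
  intro h
  apply hx
  funext i
  simpa using congrFun h i.succ

lemma one_zero_ne_zero {N : ℕ} : (Fin.cons 1 0 : Fin (N + 1) → ℂ) ≠ 0 := by
  intro h
  simpa using congrFun h 0

/-- The distinguished point `[1 : 0 : ⋯ : 0]`. -/
def e0 {N : ℕ} : Projectivization ℂ (Fin (N + 1) → ℂ) :=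
  Projectivization.mk ℂ (Fin.cons 1 0) one_zero_ne_zero

/-- The vanishing locus in `ℙ^{N-1}` of a polynomial in `N` variables (for homogeneous
polynomials vanishing does not depend on the representative; we require vanishing at
every representative). -/
def Vp {N : ℕ} (h : MvPolynomial (Fin N) ℂ) : Set (Projectivization ℂ (Fin N → ℂ)) :=
  { p | ∀ (w : Fin N → ℂ) (hw : w ≠ 0), p = Projectivization.mk ℂ w hw → eval w h = 0 }

/-- The "open part" of the cone over `X ⊆ ℙⁿ`: all points `[u : x]` with `[x] ∈ X`. -/
def coneO {n : ℕ} (X : Set (Projectivization ℂ (Fin (n + 1) → ℂ))) :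
    Set (Projectivization ℂ (Fin (n + 2) → ℂ)) :=
  { q | ∃ (u : ℂ) (x : Fin (n + 1) → ℂ) (hx : x ≠ 0),
      Projectivization.mk ℂ x hx ∈ X ∧
        q = Projectivization.mk ℂ (Fin.cons u x) (cons_ne_zero u hx) }

/-- The cone `X̃ ⊆ ℙ^{n+1}` over `X ⊆ ℙⁿ`. -/
def cone {n : ℕ} (X : Set (Projectivization ℂ (Fin (n + 1) → ℂ))) :
    Set (Projectivization ℂ (Fin (n + 2) → ℂ)) :=
  coneO X ∪ {e0}

end UGen

namespace UGen

lemma isQuotientMap_mk' {N : ℕ} :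
    Topology.IsQuotientMap
      (Projectivization.mk' ℂ : { v : Fin N → ℂ // v ≠ 0 } → Projectivization ℂ (Fin N → ℂ)) :=
  isQuotientMap_quot_mk

/-- The affine cone over `X`, including the origin. -/
def affineCone {N : ℕ} (X : Set (Projectivization ℂ (Fin N → ℂ))) : Set (Fin N → ℂ) :=
  { x | ∀ hx : x ≠ 0, Projectivization.mk ℂ x hx ∈ X }

lemma isClosed_affineCone {N : ℕ} {X : Set (Projectivization ℂ (Fin N → ℂ))}
    (hX : IsClosed X) : IsClosed (affineCone X) := by
  have h : IsOpen (Projectivization.mk' ℂ ⁻¹' Xᶜ : Set { v : Fin N → ℂ // v ≠ 0 }) :=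
    hX.isOpen_compl.preimage isQuotientMap_mk'.continuous
  have h' := (isOpen_ne (x := (0 : Fin N → ℂ))).isOpenMap_subtype_val _ h
  rw [← isOpen_compl_iff]
  convert h' using 1
  ext x
  simp only [affineCone, Set.mem_compl_iff, Set.mem_ofPred_eq, Set.mem_image, Set.mem_preimage,
    not_forall]
  constructor
  · rintro ⟨hx, hxX⟩
    exact ⟨⟨x, hx⟩, hxX, rfl⟩
  · rintro ⟨⟨y, hy⟩, hyX, rfl⟩
    exact ⟨hy, hyX⟩

lemma mk_mem_cone_iff {n : ℕ} {X : Set (Projectivization ℂ (Fin (n + 1) → ℂ))}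
    {v : Fin (n + 2) → ℂ} (hv : v ≠ 0) :
    Projectivization.mk ℂ v hv ∈ coneO X ∪ {e0} ↔ Fin.tail v ∈ affineCone X := by
  constructor
  · rintro (⟨u, x, hx, hxX, h⟩ | h)
    · obtain ⟨a, ha⟩ := (Projectivization.mk_eq_mk_iff' _ _ _ _ _).1 h
      have ht : a • x = Fin.tail v := by
        rw [← ha]
        funext i
        simp [Fin.tail]
      intro hne
      rwa [(Projectivization.mk_eq_mk_iff' ℂ (Fin.tail v) x hne hx).2 ⟨a, ht⟩]
    · obtain ⟨a, ha⟩ := (Projectivization.mk_eq_mk_iff' _ _ _ _ _).1 h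
      intro hne
      refine absurd ?_ hne
      rw [← ha]
      funext i
      simp [Fin.tail]
  · intro h
    by_cases hx : Fin.tail v = 0
    · right
      refine (Projectivization.mk_eq_mk_iff' _ _ _ _ _).2 ⟨v 0, ?_⟩
      funext i
      refine Fin.cases (by simp) (fun j => ?_) i
      simpa [Fin.tail] using (congrFun hx j).symm
    · left
      refine ⟨v 0, Fin.tail v, hx, h hx, ?_⟩
      congr 1
      exact (Fin.cons_self_tail v).symm

lemma isClosed_coneO_union_e0 {n : ℕ} {X : Set (Projectivization ℂ (Fin (n + 1) → ℂ))}
    (hX : IsClosed X) : IsClosed (coneO X ∪ {e0}) := by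
  rw [← isQuotientMap_mk'.isClosed_preimage]
  have h : Continuous fun v : { v : Fin (n + 2) → ℂ // v ≠ 0 } => Fin.tail v.1 :=
    continuous_pi fun i => (continuous_apply i.succ).comp continuous_subtype_val
  convert (isClosed_affineCone hX).preimage h using 1
  ext ⟨v, hv⟩
  exact mk_mem_cone_iff hv

lemma e0_mem_closure_coneO {n : ℕ} {X : Set (Projectivization ℂ (Fin (n + 1) → ℂ))}
    (hX : X.Nonempty) : e0 ∈ closure (coneO X) := by
  obtain ⟨p, hp⟩ := hX
  induction p using Projectivization.ind with
  | h x hx =>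
  have hne (t : ℂ) : (Fin.cons 1 (t • x) : Fin (n + 2) → ℂ) ≠ 0 := fun h => by
    simpa using congrFun h 0
  let f : ℂ → Projectivization ℂ (Fin (n + 2) → ℂ) := fun t =>
    Projectivization.mk' ℂ ⟨Fin.cons 1 (t • x), hne t⟩
  have hf : Continuous f := by
    refine isQuotientMap_mk'.continuous.comp (Continuous.subtype_mk ?_ _)
    refine continuous_pi (Fin.cases ?_ fun i => ?_)
    · simpa using continuous_const
    · simpa using continuous_mul_const (x i)
  have h0 : f 0 = e0 := by simp [f, e0]
  have hcl : (0 : ℂ) ∈ closure ({0}ᶜ : Set ℂ) := dense_compl_singleton 0 0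
  rw [← h0]
  refine map_mem_closure hf hcl fun t ht => ?_
  refine ⟨1, t • x, smul_ne_zero ht hx, ?_, rfl⟩
  rwa [(Projectivization.mk_eq_mk_iff' ℂ (t • x) x _ hx).2 ⟨t, rfl⟩]

end UGen

/-- For a nonempty closed `X ⊆ ℙⁿ`, the closure in `ℙ^{n+1}` of
`S = {[u : x] : [x] ∈ X}` is exactly `S ∪ {[1 : 0 : ⋯ : 0]}`. -/
theorem statement0 {n : ℕ} (X : Set (Projectivization ℂ (Fin (n + 1) → ℂ)))
    (hXne : X.Nonempty) (hXcl : IsClosed X) :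
    closure (UGen.coneO X) = UGen.coneO X ∪ {UGen.e0} := by
  refine (closure_minimal Set.subset_union_left
    (UGen.isClosed_coneO_union_e0 hXcl)).antisymm ?_
  exact Set.union_subset subset_closure
    (Set.singleton_subset_iff.2 (UGen.e0_mem_closure_coneO hXne))
end
end

section
/- Let X ⊆ ℙⁿ be a closed subset, let ℓ ∈ ℂ[x₀, …, xₙ] be homogeneous of degree 1, and suppose W := X ∩ V(ℓ) is finite. Let g₀ ∈ ℂ[u, x₀, …, xₙ] be homogeneous of degree d ≥ 1 with g₀(1, 0, …, 0) ≠ 0, and suppose that for each point of W, with some (equivalently, any) nonzero representative x ∈ ℂ^{n+1}, the univariate polynomial u ↦ g₀(u, x) has exactly d distinct complex roots. Then X̃ ∩ V(g₀) ∩ V(ℓ) is a finite set of cardinality d · |W|. -/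
open MvPolynomial

noncomputable section

namespace UGen

lemma eval_smul_of_isHomogeneous {N d : ℕ} {g : MvPolynomial (Fin N) ℂ}
    (hg : g.IsHomogeneous d) (a : ℂ) (x : Fin N → ℂ) :
    eval (a • x) g = a ^ d * eval x g := by
  rw [eval_eq, eval_eq, Finset.mul_sum]
  refine Finset.sum_congr rfl fun m hm => ?_
  have hdeg : ∑ i ∈ m.support, m i = d := by
    have h := hg (mem_support_iff.mp hm)
    rwa [Finsupp.weight_apply, Finsupp.sum, Finset.sum_congr rfl fun i _ => by
      rw [Pi.one_apply, smul_eq_mul, mul_one]] at h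
  simp only [Pi.smul_apply, smul_eq_mul, mul_pow, Finset.prod_mul_distrib,
    Finset.prod_pow_eq_pow_sum, hdeg]
  ring

lemma mem_Vp_of_isHomogeneous {N d : ℕ} {g : MvPolynomial (Fin N) ℂ}
    (hg : g.IsHomogeneous d) {x : Fin N → ℂ} (hx : x ≠ 0) (h : eval x g = 0) :
    Projectivization.mk ℂ x hx ∈ Vp g := by
  intro w hw hxw
  obtain ⟨a, ha⟩ := (Projectivization.mk_eq_mk_iff' ℂ w x hw hx).mp hxw.symm
  rw [← ha, eval_smul_of_isHomogeneous hg, h, mul_zero]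

lemma smul_cons {N : ℕ} (a u : ℂ) (x : Fin N → ℂ) :
    a • (Fin.cons u x : Fin (N + 1) → ℂ) = Fin.cons (a * u) (a • x) := by
  funext i
  refine Fin.cases ?_ (fun j => ?_) i <;> simp

lemma eval_rename_succ {N : ℕ} (u : ℂ) (x : Fin N → ℂ) (p : MvPolynomial (Fin N) ℂ) :
    eval (Fin.cons u x : Fin (N + 1) → ℂ) (rename Fin.succ p) = eval x p := by
  rw [eval_rename]
  rfl

/-- Every point of the form `[u : x]` can be rewritten using another representative of `[x]`. -/
lemma exists_mk_cons_eq {N : ℕ} (u : ℂ) {x y : Fin N → ℂ} (hx : x ≠ 0) (hy : y ≠ 0)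
    (h : Projectivization.mk ℂ x hx = Projectivization.mk ℂ y hy) :
    ∃ v : ℂ, Projectivization.mk ℂ (Fin.cons u x : Fin (N + 1) → ℂ) (cons_ne_zero u hx) =
      Projectivization.mk ℂ (Fin.cons v y : Fin (N + 1) → ℂ) (cons_ne_zero v hy) := by
  obtain ⟨a, ha⟩ := (Projectivization.mk_eq_mk_iff ℂ y x hy hx).mp h.symm
  refine ⟨a * u, Eq.symm ((Projectivization.mk_eq_mk_iff ℂ _ _ _ _).mpr ⟨a, ?_⟩)⟩
  rw [← ha]
  exact smul_cons (a : ℂ) u x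

/-- The point `[u : x]` of the cone, where `x` is the chosen representative of `p`. -/
def conePoint {N : ℕ} (y : (_ : Projectivization ℂ (Fin N → ℂ)) × ℂ) :
    Projectivization ℂ (Fin (N + 1) → ℂ) :=
  Projectivization.mk ℂ (Fin.cons y.2 y.1.rep) (cons_ne_zero y.2 y.1.rep_nonzero)

lemma conePoint_injective {N : ℕ} : Function.Injective (conePoint (N := N)) := by
  rintro ⟨p, u⟩ ⟨q, v⟩ h
  obtain ⟨a, ha⟩ := (Projectivization.mk_eq_mk_iff' ℂ _ _ _ _).mp h
  simp only [smul_cons, Fin.cons_inj] at ha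
  obtain ⟨huv, hpq⟩ := ha
  have hp : p = q := by
    rw [← p.mk_rep, ← q.mk_rep]
    exact (Projectivization.mk_eq_mk_iff' ℂ _ _ _ _).mpr ⟨a, hpq⟩
  subst hp
  have ha : a = 1 := by
    refine smul_left_injective ℂ p.rep_nonzero ?_
    simpa using hpq
  rw [ha, one_mul] at huv
  rw [huv]

lemma mem_cone_inter_iff {n d : ℕ} {X : Set (Projectivization ℂ (Fin (n + 1) → ℂ))}
    {ℓ : MvPolynomial (Fin (n + 1)) ℂ} {g : MvPolynomial (Fin (n + 2)) ℂ}
    (hg : g.IsHomogeneous d) (hge : eval (Fin.cons 1 0) g ≠ 0)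
    (q : Projectivization ℂ (Fin (n + 2) → ℂ)) :
    q ∈ cone X ∩ Vp g ∩ Vp (rename Fin.succ ℓ) ↔
      ∃ p ∈ X ∩ Vp ℓ, ∃ u : ℂ, eval (Fin.cons u p.rep) g = 0 ∧ conePoint ⟨p, u⟩ = q := by
  constructor
  · rintro ⟨⟨hq | hq, hqg⟩, hqℓ⟩
    · obtain ⟨u, x, hx, hxX, rfl⟩ := hq
      refine ⟨_, ⟨hxX, fun w hw hxw => ?_⟩, ?_⟩
      · obtain ⟨v, hv⟩ := exists_mk_cons_eq u hx hw hxw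
        rw [← eval_rename_succ v]
        exact hqℓ _ _ hv
      · obtain ⟨v, hv⟩ := exists_mk_cons_eq u hx (Projectivization.rep_nonzero _)
          (Projectivization.mk_rep _).symm
        exact ⟨v, hqg _ _ hv, hv.symm⟩
    · exact absurd (hqg _ one_zero_ne_zero hq) hge
  · rintro ⟨p, ⟨hpX, hpℓ⟩, u, hu, rfl⟩
    refine ⟨⟨Or.inl ⟨u, p.rep, p.rep_nonzero, by rwa [p.mk_rep], rfl⟩,
      mem_Vp_of_isHomogeneous hg _ hu⟩, fun w hw hpw => ?_⟩
    obtain ⟨a, rfl⟩ := (Projectivization.mk_eq_mk_iff ℂ _ _ _ _).mp hpw.symm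
    rw [Units.smul_def, smul_cons, eval_rename_succ]
    refine hpℓ _ (smul_ne_zero a.ne_zero p.rep_nonzero) ?_
    conv_lhs => rw [← p.mk_rep]
    exact ((Projectivization.mk_eq_mk_iff ℂ _ _ _ _).mpr ⟨a, rfl⟩).symm

end UGen

/-- With `W = X ∩ V(ℓ)` finite and each fiber polynomial `u ↦ g₀(u,x)` having
exactly `d` distinct roots, `X̃ ∩ V(g₀) ∩ V(ℓ)` is a finite set of cardinality `d · |W|`. -/
theorem statement3 {n d : ℕ} (X : Set (Projectivization ℂ (Fin (n + 1) → ℂ)))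
    (hXcl : IsClosed X)
    (ℓ : MvPolynomial (Fin (n + 1)) ℂ) (hℓ : ℓ.IsHomogeneous 1)
    (hWfin : (X ∩ UGen.Vp ℓ).Finite)
    (g0 : MvPolynomial (Fin (n + 2)) ℂ) (hg0 : g0.IsHomogeneous d) (hd : 1 ≤ d)
    (hg0e : eval (Fin.cons 1 0) g0 ≠ 0)
    (hroots : ∀ p ∈ X ∩ UGen.Vp ℓ, ∀ (x : Fin (n + 1) → ℂ) (hx : x ≠ 0),
      p = Projectivization.mk ℂ x hx →
        {u : ℂ | eval (Fin.cons u x) g0 = 0}.ncard = d) :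
    (UGen.cone X ∩ UGen.Vp g0 ∩ UGen.Vp (rename Fin.succ ℓ)).Finite ∧
      (UGen.cone X ∩ UGen.Vp g0 ∩ UGen.Vp (rename Fin.succ ℓ)).ncard =
        d * (X ∩ UGen.Vp ℓ).ncard := by
  classical
  have hfib : ∀ p ∈ X ∩ UGen.Vp ℓ, ∃ F : Finset ℂ,
      (∀ u, u ∈ F ↔ eval (Fin.cons u p.rep) g0 = 0) ∧ F.card = d := by
    intro p hp
    have hcard := hroots p hp p.rep p.rep_nonzero p.mk_rep.symm
    have hfin := Set.finite_of_ncard_pos (hcard ▸ hd)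
    exact ⟨hfin.toFinset, fun u => by simp, by rw [← Set.ncard_eq_toFinset_card _ hfin, hcard]⟩
  choose! F hF hFcard using hfib
  have hS : UGen.cone X ∩ UGen.Vp g0 ∩ UGen.Vp (rename Fin.succ ℓ) =
      ((hWfin.toFinset.sigma F).image UGen.conePoint : Finset _) := by
    ext q
    rw [UGen.mem_cone_inter_iff hg0 hg0e]
    simp only [Finset.coe_image, Set.mem_image, Finset.mem_coe, Finset.mem_sigma,
      Set.Finite.mem_toFinset]
    constructor
    · rintro ⟨p, hp, u, hu, rfl⟩
      exact ⟨⟨p, u⟩, ⟨hp, (hF p hp u).mpr hu⟩, rfl⟩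
    · rintro ⟨⟨p, u⟩, ⟨hp, hu⟩, rfl⟩
      exact ⟨p, hp, u, (hF p hp u).mp hu, rfl⟩
  rw [hS]
  refine ⟨Finset.finite_toSet _, ?_⟩
  rw [Set.ncard_coe_finset, Finset.card_image_of_injective _ UGen.conePoint_injective,
    Finset.card_sigma, Finset.sum_congr rfl fun p hp => hFcard p (hWfin.mem_toFinset.mp hp),
    Finset.sum_const, smul_eq_mul, mul_comm, ← Set.ncard_eq_toFinset_card _ hWfin]
end
end

section
/- Let X ⊆ ℙⁿ be a closed subset, let ℓ ∈ ℂ[x₀, …, xₙ] be homogeneous of degree 1, and let t ∈ (0, 1]. Then X̃ ∩ V((1−t)ℓ + t·u) = { [−(1−t)ℓ(x) : t·x] : [x] ∈ X }, and the map [x] ↦ [−(1−t)ℓ(x) : t·x] is a well-defined bijection from X onto X̃ ∩ V((1−t)ℓ + t·u). -/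
open MvPolynomial

noncomputable section

namespace UGen

lemma eval_smul_of_isHomogeneous_s4 {σ R : Type*} [CommSemiring R] {p : MvPolynomial σ R} {m : ℕ}
    (hp : p.IsHomogeneous m) (a : R) (x : σ → R) : eval (a • x) p = a ^ m * eval x p := by
  rw [eval_eq, eval_eq, Finset.mul_sum]
  refine Finset.sum_congr rfl fun d hd => ?_
  have hdeg : ∑ i ∈ d.support, d i = m := by
    rw [← hp (mem_support_iff.mp hd), Finsupp.weight_apply]
    simp [Finsupp.sum]
  simp only [Pi.smul_apply, smul_eq_mul, mul_pow, Finset.prod_mul_distrib,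
    Finset.prod_pow_eq_pow_sum, hdeg]
  ring

lemma mk_mem_Vp_iff {N m : ℕ} {h : MvPolynomial (Fin N) ℂ} (hh : h.IsHomogeneous m)
    {w : Fin N → ℂ} (hw : w ≠ 0) : Projectivization.mk ℂ w hw ∈ Vp h ↔ eval w h = 0 := by
  refine ⟨fun H => H w hw rfl, fun H v hv hwv => ?_⟩
  obtain ⟨a, rfl⟩ := (Projectivization.mk_eq_mk_iff' ℂ v w hv hw).mp hwv.symm
  rw [eval_smul_of_isHomogeneous_s4 hh, H, mul_zero]

lemma isHomogeneous_hyperplane {N : ℕ} {ℓ : MvPolynomial (Fin N) ℂ} (hℓ : ℓ.IsHomogeneous 1)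
    (s c : ℂ) : (C s * rename Fin.succ ℓ + C c * MvPolynomial.X 0 :
      MvPolynomial (Fin (N + 1)) ℂ).IsHomogeneous 1 :=
  (hℓ.rename_isHomogeneous.C_mul s).add ((isHomogeneous_X ℂ 0).C_mul c)

lemma eval_hyperplane {N : ℕ} (ℓ : MvPolynomial (Fin N) ℂ) (s c u : ℂ) (x : Fin N → ℂ) :
    eval (Fin.cons u x : Fin (N + 1) → ℂ) (C s * rename Fin.succ ℓ + C c * MvPolynomial.X 0) =
      s * eval x ℓ + c * u := by
  simp [eval_rename, Function.comp_def]

/-- The points of the cone on the hyperplane `s * ℓ + c * u = 0` are the `[-s * ℓ(x) : c * x]`. -/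
lemma cone_inter_Vp_hyperplane {n : ℕ} (X : Set (Projectivization ℂ (Fin (n + 1) → ℂ)))
    {ℓ : MvPolynomial (Fin (n + 1)) ℂ} (hℓ : ℓ.IsHomogeneous 1) (s : ℂ) {c : ℂ} (hc : c ≠ 0) :
    cone X ∩ Vp (C s * rename Fin.succ ℓ + C c * MvPolynomial.X 0) =
      { q | ∃ (x : Fin (n + 1) → ℂ) (hx : x ≠ 0), Projectivization.mk ℂ x hx ∈ X ∧
          q = Projectivization.mk ℂ (Fin.cons (-s * eval x ℓ) (c • x))
            (cons_ne_zero _ (smul_ne_zero hc hx)) } := by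
  have hhom := isHomogeneous_hyperplane hℓ s c
  ext q
  constructor
  · rintro ⟨⟨u, x, hx, hxX, rfl⟩ | rfl, hq⟩
    · rw [mk_mem_Vp_iff hhom, eval_hyperplane] at hq
      refine ⟨x, hx, hxX, ((Projectivization.mk_eq_mk_iff' ..).mpr ⟨c, ?_⟩).symm⟩
      rw [smul_cons, show c * u = -s * eval x ℓ by linear_combination hq]
    · have hℓ0 : eval 0 ℓ = 0 := by
        simpa using eval_smul_of_isHomogeneous_s4 hℓ 0 0
      rw [e0, mk_mem_Vp_iff hhom, eval_hyperplane, hℓ0] at hq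
      exact absurd (by simpa using hq) hc
  · rintro ⟨x, hx, hxX, rfl⟩
    refine ⟨Or.inl ⟨_, c • x, smul_ne_zero hc hx, ?_, rfl⟩, ?_⟩
    · rwa [(Projectivization.mk_eq_mk_iff' ..).mpr ⟨c, rfl⟩]
    · rw [mk_mem_Vp_iff hhom, eval_hyperplane, eval_smul_of_isHomogeneous_s4 hℓ]
      ring

end UGen

/-- For `t ∈ (0,1]`, `X̃ ∩ V((1−t)ℓ + t·u) = {[−(1−t)ℓ(x) : t·x] : [x] ∈ X}`,
and `[x] ↦ [−(1−t)ℓ(x) : t·x]` is a well-defined bijection from `X` onto this set. -/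
theorem statement4 {n : ℕ} (X : Set (Projectivization ℂ (Fin (n + 1) → ℂ)))
    (hXcl : IsClosed X)
    (ℓ : MvPolynomial (Fin (n + 1)) ℂ) (hℓ : ℓ.IsHomogeneous 1)
    (t : ℝ) (ht : t ∈ Set.Ioc (0 : ℝ) 1) :
    (UGen.cone X ∩
        UGen.Vp (C (1 - (t : ℂ)) * rename Fin.succ ℓ + C (t : ℂ) * MvPolynomial.X 0) =
      { q | ∃ (x : Fin (n + 1) → ℂ) (hx : x ≠ 0),
          Projectivization.mk ℂ x hx ∈ X ∧
            q = Projectivization.mk ℂ (Fin.cons (-(1 - (t : ℂ)) * eval x ℓ) ((t : ℂ) • x))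
              (UGen.cons_ne_zero _
                (smul_ne_zero (Complex.ofReal_ne_zero.mpr ht.1.ne') hx)) }) ∧
    ∃ f : Projectivization ℂ (Fin (n + 1) → ℂ) → Projectivization ℂ (Fin (n + 2) → ℂ),
      (∀ (x : Fin (n + 1) → ℂ) (hx : x ≠ 0),
        f (Projectivization.mk ℂ x hx) =
          Projectivization.mk ℂ (Fin.cons (-(1 - (t : ℂ)) * eval x ℓ) ((t : ℂ) • x))
            (UGen.cons_ne_zero _
              (smul_ne_zero (Complex.ofReal_ne_zero.mpr ht.1.ne') hx))) ∧
      Set.BijOn f X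
        (UGen.cone X ∩
          UGen.Vp (C (1 - (t : ℂ)) * rename Fin.succ ℓ + C (t : ℂ) * MvPolynomial.X 0)) := by
  have hc : (t : ℂ) ≠ 0 := Complex.ofReal_ne_zero.mpr ht.1.ne'
  have hset := UGen.cone_inter_Vp_hyperplane X hℓ (1 - (t : ℂ)) hc
  refine ⟨hset, Projectivization.lift
    (fun v => Projectivization.mk ℂ (Fin.cons (-(1 - (t : ℂ)) * eval v.1 ℓ) ((t : ℂ) • v.1))
      (UGen.cons_ne_zero _ (smul_ne_zero hc v.2))) ?_, fun _ _ => rfl, ?_⟩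
  · rintro ⟨_, ha⟩ ⟨b, hb⟩ r rfl
    refine (Projectivization.mk_eq_mk_iff' ..).mpr ⟨r, ?_⟩
    rw [UGen.smul_cons, UGen.eval_smul_of_isHomogeneous_s4 hℓ, smul_comm, pow_one, mul_left_comm]
  · rw [hset]
    refine ⟨fun p hp => ?_, fun p _ q _ hpq => ?_, ?_⟩
    · induction p with | h x hx => exact ⟨x, hx, hp, rfl⟩
    · induction p with | h x hx =>
      induction q with | h y hy =>
      obtain ⟨a, ha⟩ := (Projectivization.mk_eq_mk_iff' ..).mp hpq
      refine (Projectivization.mk_eq_mk_iff' ..).mpr ⟨a, smul_right_injective _ hc ?_⟩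
      rw [UGen.smul_cons] at ha
      exact (smul_comm (t : ℂ) a y).trans (Fin.cons_inj.mp ha).2
    · rintro _ ⟨x, hx, hxX, rfl⟩
      exact ⟨_, hxX, rfl⟩
end
end

section
/- Let X ⊆ ℙᵐ × ℙⁿ be a nonempty closed subset (in the product of the quotient Euclidean topologies) with coordinate projections π_x and π_y onto the two factors. Then the closure in ℙ^{m+1} × ℙ^{n+1} of the set T = { ([u : x], [v : y]) : ([x], [y]) ∈ X, u, v ∈ ℂ } is exactly T ∪ { ([u : x], [1 : 𝟎]) : [x] ∈ π_x(X), u ∈ ℂ } ∪ { ([1 : 𝟎], [v : y]) : [y] ∈ π_y(X), v ∈ ℂ } ∪ { ([1 : 𝟎], [1 : 𝟎]) }; in particular, this union is closed. -/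
open MvPolynomial

noncomputable section

namespace UGen

lemma cons_pair_ne_zero {N : ℕ} {a b : ℂ} (hab : (a, b) ≠ (0, 0)) {x : Fin N → ℂ}
    (hx : x ≠ 0) : (Fin.cons a (b • x) : Fin (N + 1) → ℂ) ≠ 0 := by
  rcases eq_or_ne b 0 with hb | hb
  · subst hb
    have ha : a ≠ 0 := by simpa using hab
    intro h
    exact ha (by simpa using congrFun h 0)
  · exact cons_ne_zero a (smul_ne_zero hb hx)

/-- Bihomogeneity of bidegree `(d, e)` in two groups of variables,
phrased via weighted homogeneity with weights `(1,0)` and `(0,1)`. -/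
def IsBihomogeneous {a b : ℕ} (g : MvPolynomial (Fin a ⊕ Fin b) ℂ) (d e : ℕ) : Prop :=
  g.IsWeightedHomogeneous
    (Sum.elim (fun _ => ((1 : ℕ), (0 : ℕ))) (fun _ => ((0 : ℕ), (1 : ℕ)))) (d, e)

/-- The vanishing locus, in a product of two projectivizations, of a polynomial in the two
groups of variables (for bihomogeneous polynomials vanishing does not depend on the chosen
representatives; we require vanishing at every pair of representatives). -/
def Vbi {a b : ℕ} (h : MvPolynomial (Fin a ⊕ Fin b) ℂ) :
    Set (Projectivization ℂ (Fin a → ℂ) × Projectivization ℂ (Fin b → ℂ)) :=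
  { p | ∀ (w₁ : Fin a → ℂ) (h₁ : w₁ ≠ 0) (w₂ : Fin b → ℂ) (h₂ : w₂ ≠ 0),
      p = (Projectivization.mk ℂ w₁ h₁, Projectivization.mk ℂ w₂ h₂) →
        eval (Sum.elim w₁ w₂) h = 0 }

variable {m n : ℕ}
  (X : Set (Projectivization ℂ (Fin (m + 1) → ℂ) × Projectivization ℂ (Fin (n + 1) → ℂ)))

/-- The "open part" of the double cone: all points `([u : x], [v : y])` with `([x],[y]) ∈ X`. -/
def dcT : Set (Projectivization ℂ (Fin (m + 2) → ℂ) × Projectivization ℂ (Fin (n + 2) → ℂ)) :=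
  { q | ∃ (u v : ℂ) (x : Fin (m + 1) → ℂ) (y : Fin (n + 1) → ℂ) (hx : x ≠ 0) (hy : y ≠ 0),
      (Projectivization.mk ℂ x hx, Projectivization.mk ℂ y hy) ∈ X ∧
        q = (Projectivization.mk ℂ (Fin.cons u x) (cons_ne_zero u hx),
             Projectivization.mk ℂ (Fin.cons v y) (cons_ne_zero v hy)) }

/-- The part `{([u : x], [1 : 𝟎]) : [x] ∈ π_x(X)}` of the double cone. -/
def dcA : Set (Projectivization ℂ (Fin (m + 2) → ℂ) × Projectivization ℂ (Fin (n + 2) → ℂ)) :=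
  { q | ∃ (u : ℂ) (x : Fin (m + 1) → ℂ) (hx : x ≠ 0),
      Projectivization.mk ℂ x hx ∈ Prod.fst '' X ∧
        q = (Projectivization.mk ℂ (Fin.cons u x) (cons_ne_zero u hx), e0) }

/-- The part `{([1 : 𝟎], [v : y]) : [y] ∈ π_y(X)}` of the double cone. -/
def dcB : Set (Projectivization ℂ (Fin (m + 2) → ℂ) × Projectivization ℂ (Fin (n + 2) → ℂ)) :=
  { q | ∃ (v : ℂ) (y : Fin (n + 1) → ℂ) (hy : y ≠ 0),
      Projectivization.mk ℂ y hy ∈ Prod.snd '' X ∧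
        q = (e0, Projectivization.mk ℂ (Fin.cons v y) (cons_ne_zero v hy)) }

/-- The double cone `X̃ ⊆ ℙ^{m+1} × ℙ^{n+1}` of `X ⊆ ℙᵐ × ℙⁿ`. -/
def doubleCone :
    Set (Projectivization ℂ (Fin (m + 2) → ℂ) × Projectivization ℂ (Fin (n + 2) → ℂ)) :=
  dcT X ∪ dcA X ∪ dcB X ∪ {(e0, e0)}

end UGen

namespace UGen

lemma continuous_mk' {N : ℕ} :
    Continuous (Projectivization.mk' ℂ : { v : Fin N → ℂ // v ≠ 0 } → _) :=
  continuous_quot_mk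

lemma isOpenQuotientMap_mk' {N : ℕ} :
    IsOpenQuotientMap (Projectivization.mk' ℂ : { v : Fin N → ℂ // v ≠ 0 } → _) where
  surjective := Quotient.mk_surjective
  continuous := continuous_mk'
  isOpenMap U hU := by
    have key : Projectivization.mk' ℂ ⁻¹' (Projectivization.mk' ℂ '' U) =
        ⋃ a : ℂˣ, (fun v : { v : Fin N → ℂ // v ≠ 0 } =>
          (⟨a • v.1, (smul_ne_zero_iff_ne a).2 v.2⟩ : { v : Fin N → ℂ // v ≠ 0 })) ⁻¹' U := by
      ext v
      simp only [Set.mem_preimage, Set.mem_image, Set.mem_iUnion]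
      constructor
      · rintro ⟨w, hw, h⟩
        obtain ⟨a, ha⟩ := (Projectivization.mk_eq_mk_iff ℂ _ _ w.2 v.2).1 h
        exact ⟨a, by convert hw⟩
      · rintro ⟨a, ha⟩
        exact ⟨_, ha, (Projectivization.mk_eq_mk_iff ℂ _ _ _ v.2).2 ⟨a, rfl⟩⟩
    have hq : Topology.IsQuotientMap
        (Projectivization.mk' ℂ : { v : Fin N → ℂ // v ≠ 0 } → _) := isQuotientMap_quot_mk
    rw [← hq.isOpen_preimage, key]
    refine isOpen_iUnion fun a => hU.preimage ?_
    exact (continuous_subtype_val.const_smul a).subtype_mk _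

instance {N : ℕ} : CompactSpace (Projectivization ℂ (Fin N → ℂ)) := by
  let f : Metric.sphere (0 : Fin N → ℂ) 1 → Projectivization ℂ (Fin N → ℂ) :=
    fun v => Projectivization.mk' ℂ ⟨v.1, ne_zero_of_mem_unit_sphere v⟩
  have hf : Continuous f := continuous_mk'.comp (continuous_subtype_val.subtype_mk _)
  have hs : Function.Surjective f := fun p => by
    induction p using Projectivization.ind with
    | h v hv =>
      refine ⟨⟨((‖v‖⁻¹ : ℝ) : ℂ) • v, ?_⟩, ?_⟩
      · simp [norm_smul, hv]
      · exact (Projectivization.mk_eq_mk_iff' ℂ _ _ _ hv).2 ⟨_, rfl⟩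
  exact hs.compactSpace hf

lemma mk_cons_tail {N : ℕ} (w : Fin (N + 1) → ℂ) (hw : w ≠ 0) (ht : Fin.tail w ≠ 0) :
    Projectivization.mk ℂ w hw =
      Projectivization.mk ℂ (Fin.cons (w 0) (Fin.tail w)) (cons_ne_zero (w 0) ht) := by
  congr 1
  exact (Fin.cons_self_tail w).symm

lemma mk_eq_e0_iff {N : ℕ} (w : Fin (N + 1) → ℂ) (hw : w ≠ 0) :
    Projectivization.mk ℂ w hw = e0 ↔ Fin.tail w = 0 := by
  rw [e0, Projectivization.mk_eq_mk_iff']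
  constructor
  · rintro ⟨a, rfl⟩
    ext i
    simp [Fin.tail]
  · intro h
    refine ⟨w 0, ?_⟩
    ext i
    refine Fin.cases ?_ (fun j => ?_) i
    · simp
    · simpa [Fin.tail] using (congrFun h j).symm

lemma exists_mk_tail_eq {N : ℕ} {w : Fin (N + 1) → ℂ} {hw : w ≠ 0} {u : ℂ} {x : Fin N → ℂ}
    {hx : x ≠ 0}
    (h : Projectivization.mk ℂ w hw = Projectivization.mk ℂ (Fin.cons u x) (cons_ne_zero u hx)) :
    ∃ ht : Fin.tail w ≠ 0, Projectivization.mk ℂ (Fin.tail w) ht = Projectivization.mk ℂ x hx := by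
  obtain ⟨a, rfl⟩ := (Projectivization.mk_eq_mk_iff ℂ _ _ _ _).1 h
  have e : Fin.tail (a • (Fin.cons u x : Fin (N + 1) → ℂ)) = a • x := by
    ext i
    simp [Fin.tail]
  have ht : Fin.tail (a • (Fin.cons u x : Fin (N + 1) → ℂ)) ≠ 0 := by
    rw [e]
    exact (smul_ne_zero_iff_ne a).2 hx
  exact ⟨ht, (Projectivization.mk_eq_mk_iff ℂ _ _ _ _).2 ⟨a, e.symm⟩⟩

/-- The affine cone, without its vertex, over an open subset of projective space is open. -/
lemma isOpen_affineCone {N : ℕ} {U : Set (Projectivization ℂ (Fin N → ℂ))} (hU : IsOpen U) :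
    IsOpen {x : Fin N → ℂ | ∃ hx : x ≠ 0, Projectivization.mk ℂ x hx ∈ U} := by
  have h0 : IsOpen {x : Fin N → ℂ | x ≠ 0} := isOpen_ne
  convert h0.isOpenMap_subtype_val _ (hU.preimage continuous_mk') using 1
  ext x
  constructor
  · rintro ⟨hx, h⟩
    exact ⟨⟨x, hx⟩, h, rfl⟩
  · rintro ⟨⟨x, hx⟩, h, rfl⟩
    exact ⟨hx, h⟩

/-- The bi-affine cone over an open subset of a product of projective spaces is open. -/
lemma isOpen_affineCone_prod {M N : ℕ}
    {U : Set (Projectivization ℂ (Fin M → ℂ) × Projectivization ℂ (Fin N → ℂ))}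
    (hU : IsOpen U) :
    IsOpen {p : (Fin M → ℂ) × (Fin N → ℂ) | ∃ (hx : p.1 ≠ 0) (hy : p.2 ≠ 0),
      (Projectivization.mk ℂ p.1 hx, Projectivization.mk ℂ p.2 hy) ∈ U} := by
  have hM : IsOpen {x : Fin M → ℂ | x ≠ 0} := isOpen_ne
  have hN : IsOpen {x : Fin N → ℂ | x ≠ 0} := isOpen_ne
  convert (hM.isOpenMap_subtype_val.prodMap hN.isOpenMap_subtype_val) _
    (hU.preimage (continuous_mk'.prodMap continuous_mk')) using 1
  ext ⟨x, y⟩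
  constructor
  · rintro ⟨hx, hy, h⟩
    exact ⟨(⟨x, hx⟩, ⟨y, hy⟩), h, rfl⟩
  · rintro ⟨⟨⟨x, hx⟩, ⟨y, hy⟩⟩, h, e⟩
    cases e
    exact ⟨hx, hy, h⟩

lemma continuous_tail {N : ℕ} : Continuous (Fin.tail : (Fin (N + 1) → ℂ) → Fin N → ℂ) :=
  continuous_pi fun i => continuous_apply i.succ

lemma isClosed_doubleCone {m n : ℕ}
    {X : Set (Projectivization ℂ (Fin (m + 1) → ℂ) × Projectivization ℂ (Fin (n + 1) → ℂ))}
    (hX : IsClosed X) : IsClosed (doubleCone X) := by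
  rw [← isOpen_compl_iff,
    ← (isOpenQuotientMap_mk'.prodMap isOpenQuotientMap_mk').isQuotientMap.isOpen_preimage]
  have hc : Continuous fun p : { v : Fin (m + 2) → ℂ // v ≠ 0 } × { v : Fin (n + 2) → ℂ // v ≠ 0 } =>
      (Fin.tail p.1.1, Fin.tail p.2.1) :=
    (continuous_tail.comp (continuous_subtype_val.comp continuous_fst)).prodMk
      (continuous_tail.comp (continuous_subtype_val.comp continuous_snd))
  have h₁ := (isOpen_affineCone_prod hX.isOpen_compl).preimage hc
  have h₂ := (isOpen_affineCone (isClosedMap_fst_of_compactSpace _ hX).isOpen_compl).preimage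
    (continuous_fst.comp hc)
  have h₃ := (isOpen_affineCone (isClosedMap_snd_of_compactSpace _ hX).isOpen_compl).preimage
    (continuous_snd.comp hc)
  convert (h₁.union h₂).union h₃ using 1
  ext ⟨⟨w, hw⟩, ⟨z, hz⟩⟩
  simp only [Set.mem_preimage, Set.mem_compl_iff, Set.mem_union, Set.mem_ofPred_eq, Prod.map,
    Projectivization.mk'_eq_mk, Function.comp]
  constructor
  · intro h
    simp only [doubleCone, Set.mem_union, not_or] at h
    obtain ⟨⟨⟨hT, hA⟩, hB⟩, h0⟩ := h
    by_cases hw' : Fin.tail w = 0 <;> by_cases hz' : Fin.tail z = 0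
    · exact absurd (Prod.ext ((mk_eq_e0_iff w hw).2 hw') ((mk_eq_e0_iff z hz).2 hz')) h0
    · exact Or.inr ⟨hz', fun hm => hB ⟨z 0, _, hz', hm,
        Prod.ext ((mk_eq_e0_iff w hw).2 hw') (mk_cons_tail z hz hz')⟩⟩
    · exact Or.inl (Or.inr ⟨hw', fun hm => hA ⟨w 0, _, hw', hm,
        Prod.ext (mk_cons_tail w hw hw') ((mk_eq_e0_iff z hz).2 hz')⟩⟩)
    · exact Or.inl (Or.inl ⟨hw', hz', fun hm => hT ⟨w 0, z 0, _, _, hw', hz', hm,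
        Prod.ext (mk_cons_tail w hw hw') (mk_cons_tail z hz hz')⟩⟩)
  · rintro h (((⟨u, v, x, y, hx, hy, hm, e⟩ | ⟨u, x, hx, hm, e⟩) | ⟨v, y, hy, hm, e⟩) | e)
    · obtain ⟨hw', ew⟩ := exists_mk_tail_eq (Prod.ext_iff.1 e).1
      obtain ⟨hz', ez⟩ := exists_mk_tail_eq (Prod.ext_iff.1 e).2
      rw [← ew, ← ez] at hm
      rcases h with (⟨_, _, h⟩ | ⟨_, h⟩) | ⟨_, h⟩
      · exact h hm
      · exact h ⟨_, hm, rfl⟩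
      · exact h ⟨_, hm, rfl⟩
    · obtain ⟨hw', ew⟩ := exists_mk_tail_eq (Prod.ext_iff.1 e).1
      have hz' := (mk_eq_e0_iff z hz).1 (Prod.ext_iff.1 e).2
      rw [← ew] at hm
      rcases h with (⟨_, h, _⟩ | ⟨_, h⟩) | ⟨h, _⟩
      · exact h hz'
      · exact h hm
      · exact h hz'
    · obtain ⟨hz', ez⟩ := exists_mk_tail_eq (Prod.ext_iff.1 e).2
      have hw' := (mk_eq_e0_iff w hw).1 (Prod.ext_iff.1 e).1
      rw [← ez] at hm
      rcases h with (⟨h, _⟩ | ⟨h, _⟩) | ⟨_, h⟩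
      · exact h hw'
      · exact h hw'
      · exact h hm
    · have hw' := (mk_eq_e0_iff w hw).1 (Prod.ext_iff.1 e).1
      have hz' := (mk_eq_e0_iff z hz).1 (Prod.ext_iff.1 e).2
      rcases h with (⟨h, _⟩ | ⟨h, _⟩) | ⟨h, _⟩
      · exact h hw'
      · exact h hw'
      · exact h hz'

open Filter Topology in
lemma tendsto_mk_cons_inv {N : ℕ} {y : Fin N → ℂ} (hy : y ≠ 0) :
    Tendsto (fun t : ℂ => Projectivization.mk ℂ (Fin.cons t⁻¹ y) (cons_ne_zero t⁻¹ hy))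
      (𝓝[≠] 0) (𝓝 e0) := by
  have hne (t : ℂ) : (Fin.cons 1 (t • y) : Fin (N + 1) → ℂ) ≠ 0 := fun h => by
    simpa using congrFun h 0
  let f : ℂ → Projectivization ℂ (Fin (N + 1) → ℂ) := fun t => Projectivization.mk ℂ _ (hne t)
  have hc : Continuous f := by
    refine continuous_mk'.comp (Continuous.subtype_mk (continuous_pi fun i => ?_) _)
    refine Fin.cases ?_ (fun j => ?_) i
    · simpa using continuous_const
    · simpa using continuous_mul_const (y j)
  have h0 : f 0 = e0 := by
    simp [f, e0]
  refine ((h0 ▸ hc.tendsto 0).mono_left nhdsWithin_le_nhds).congr' ?_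
  filter_upwards [self_mem_nhdsWithin] with t ht
  refine (Projectivization.mk_eq_mk_iff' ℂ _ _ _ _).2 ⟨t, ?_⟩
  ext i
  refine Fin.cases ?_ (fun j => ?_) i
  · simpa using mul_inv_cancel₀ ht
  · simp

lemma doubleCone_subset_closure {m n : ℕ}
    {X : Set (Projectivization ℂ (Fin (m + 1) → ℂ) × Projectivization ℂ (Fin (n + 1) → ℂ))}
    (hX : X.Nonempty) : doubleCone X ⊆ closure (dcT X) := by
  rintro q (((hq | ⟨u, x, hx, ⟨⟨p, r⟩, hp, rfl⟩, rfl⟩) | ⟨v, y, hy, ⟨⟨p, r⟩, hp, rfl⟩, rfl⟩) | rfl)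
  · exact subset_closure hq
  · induction r using Projectivization.ind with
    | h y hy =>
      exact mem_closure_of_tendsto (tendsto_const_nhds.prodMk_nhds (tendsto_mk_cons_inv hy))
        (.of_forall fun t => ⟨u, t⁻¹, x, y, hx, hy, hp, rfl⟩)
  · induction p using Projectivization.ind with
    | h x hx =>
      exact mem_closure_of_tendsto ((tendsto_mk_cons_inv hx).prodMk_nhds tendsto_const_nhds)
        (.of_forall fun t => ⟨t⁻¹, v, x, y, hx, hy, hp, rfl⟩)
  · obtain ⟨⟨p, r⟩, hp⟩ := hX
    induction p using Projectivization.ind with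
    | h x hx =>
      induction r using Projectivization.ind with
      | h y hy =>
        exact mem_closure_of_tendsto
          ((tendsto_mk_cons_inv hx).prodMk_nhds (tendsto_mk_cons_inv hy))
          (.of_forall fun t => ⟨t⁻¹, t⁻¹, x, y, hx, hy, hp, rfl⟩)

end UGen

/-- For nonempty closed `X ⊆ ℙᵐ × ℙⁿ`, the closure in `ℙ^{m+1} × ℙ^{n+1}` of
`T = {([u : x], [v : y]) : ([x],[y]) ∈ X}` is exactly
`T ∪ {([u : x], [1 : 𝟎]) : [x] ∈ π_x(X)} ∪ {([1 : 𝟎], [v : y]) : [y] ∈ π_y(X)} ∪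
{([1 : 𝟎], [1 : 𝟎])}`. -/
theorem statement6 {m n : ℕ}
    (X : Set (Projectivization ℂ (Fin (m + 1) → ℂ) × Projectivization ℂ (Fin (n + 1) → ℂ)))
    (hXne : X.Nonempty) (hXcl : IsClosed X) :
    closure (UGen.dcT X) = UGen.dcT X ∪ UGen.dcA X ∪ UGen.dcB X ∪ {(UGen.e0, UGen.e0)} := by
  refine (closure_minimal (fun q hq => ?_) (UGen.isClosed_doubleCone hXcl)).antisymm
    (UGen.doubleCone_subset_closure hXne)
  exact Or.inl (Or.inl (Or.inl hq))
end
end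

section
/- Let X ⊆ ℙᵐ × ℙⁿ be a closed subset and let ℓ_x ∈ ℂ[x₀, …, x_m] and ℓ_y ∈ ℂ[y₀, …, y_n] be homogeneous of degree 1 with X ∩ V(ℓ_x) ∩ V(ℓ_y) = ∅. Then X̃ ∩ V(ℓ_x, ℓ_y) = { ([u : x], [1 : 𝟎]) : [x] ∈ π_x(X), ℓ_x(x) = 0, u ∈ ℂ } ∪ { ([1 : 𝟎], [v : y]) : [y] ∈ π_y(X), ℓ_y(y) = 0, v ∈ ℂ } ∪ { ([1 : 𝟎], [1 : 𝟎]) }. -/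
open MvPolynomial

noncomputable section

namespace UGen

lemma eval_smul_of_isHomogeneous_s12 {N d : ℕ} {f : MvPolynomial (Fin N) ℂ}
    (hf : f.IsHomogeneous d) (c : ℂ) (w : Fin N → ℂ) :
    eval (c • w) f = c ^ d * eval w f := by
  simp only [eval_eq, Finset.mul_sum]
  refine Finset.sum_congr rfl fun s hs => ?_
  have hd : ∑ i ∈ s.support, s i = d := by
    have := hf (mem_support_iff.mp hs)
    simpa [Finsupp.weight_apply, Finsupp.sum] using this
  simp only [Pi.smul_apply, smul_eq_mul, mul_pow, Finset.prod_mul_distrib,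
    Finset.prod_pow_eq_pow_sum, hd]
  ring

lemma eval_eq_zero_of_mk_eq {N d : ℕ} {f : MvPolynomial (Fin N) ℂ}
    (hf : f.IsHomogeneous d) {w w' : Fin N → ℂ} {hw : w ≠ 0} {hw' : w' ≠ 0}
    (h : Projectivization.mk ℂ w hw = Projectivization.mk ℂ w' hw')
    (h0 : eval w f = 0) : eval w' f = 0 := by
  obtain ⟨c, rfl⟩ := (Projectivization.mk_eq_mk_iff' ℂ w' w hw' hw).mp h.symm
  rw [eval_smul_of_isHomogeneous_s12 hf, h0, mul_zero]

lemma mem_Vbi_inl {a b d : ℕ} {f : MvPolynomial (Fin a) ℂ} (hf : f.IsHomogeneous d)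
    (w : Fin a → ℂ) (hw : w ≠ 0) (q : Projectivization ℂ (Fin b → ℂ)) :
    (Projectivization.mk ℂ w hw, q) ∈ Vbi (rename Sum.inl f) ↔ eval w f = 0 := by
  constructor
  · intro h
    simpa [eval_rename] using h w hw q.rep q.rep_nonzero (by rw [q.mk_rep])
  · intro h w₁ h₁ w₂ h₂ heq
    simpa [eval_rename] using eval_eq_zero_of_mk_eq hf (Prod.ext_iff.mp heq).1 h

lemma mem_Vbi_inr {a b d : ℕ} {f : MvPolynomial (Fin b) ℂ} (hf : f.IsHomogeneous d)
    (p : Projectivization ℂ (Fin a → ℂ)) (w : Fin b → ℂ) (hw : w ≠ 0) :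
    (p, Projectivization.mk ℂ w hw) ∈ Vbi (rename Sum.inr f) ↔ eval w f = 0 := by
  constructor
  · intro h
    simpa [eval_rename] using h p.rep p.rep_nonzero w hw (by rw [p.mk_rep])
  · intro h w₁ h₁ w₂ h₂ heq
    simpa [eval_rename] using eval_eq_zero_of_mk_eq hf (Prod.ext_iff.mp heq).2 h

lemma mem_Vbi_inl_succ {a b d : ℕ} {f : MvPolynomial (Fin a) ℂ} (hf : f.IsHomogeneous d)
    (u : ℂ) (x : Fin a → ℂ) (h : (Fin.cons u x : Fin (a + 1) → ℂ) ≠ 0)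
    (q : Projectivization ℂ (Fin b → ℂ)) :
    (Projectivization.mk ℂ (Fin.cons u x : Fin (a + 1) → ℂ) h, q) ∈
      Vbi (rename (Sum.inl ∘ Fin.succ) f) ↔ eval x f = 0 := by
  rw [← rename_rename, mem_Vbi_inl hf.rename_isHomogeneous, eval_rename]
  rfl

lemma mem_Vbi_inr_succ {a b d : ℕ} {f : MvPolynomial (Fin b) ℂ} (hf : f.IsHomogeneous d)
    (p : Projectivization ℂ (Fin a → ℂ))
    (v : ℂ) (y : Fin b → ℂ) (h : (Fin.cons v y : Fin (b + 1) → ℂ) ≠ 0) :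
    (p, Projectivization.mk ℂ (Fin.cons v y : Fin (b + 1) → ℂ) h) ∈
      Vbi (rename (Sum.inr ∘ Fin.succ) f) ↔ eval y f = 0 := by
  rw [← rename_rename, mem_Vbi_inr hf.rename_isHomogeneous, eval_rename]
  rfl

lemma eval_zero_of_isHomogeneous {N d : ℕ} (hd : d ≠ 0) {f : MvPolynomial (Fin N) ℂ}
    (hf : f.IsHomogeneous d) : eval 0 f = 0 := by
  simpa [hd] using eval_smul_of_isHomogeneous_s12 hf 0 0

lemma e0_mem_Vbi_inl_succ {a b d : ℕ} (hd : d ≠ 0) {f : MvPolynomial (Fin a) ℂ}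
    (hf : f.IsHomogeneous d) (q : Projectivization ℂ (Fin b → ℂ)) :
    (e0, q) ∈ Vbi (rename (Sum.inl ∘ Fin.succ) f) :=
  (mem_Vbi_inl_succ hf 1 0 one_zero_ne_zero q).mpr (eval_zero_of_isHomogeneous hd hf)

lemma e0_mem_Vbi_inr_succ {a b d : ℕ} (hd : d ≠ 0) {f : MvPolynomial (Fin b) ℂ}
    (hf : f.IsHomogeneous d) (p : Projectivization ℂ (Fin a → ℂ)) :
    (p, e0) ∈ Vbi (rename (Sum.inr ∘ Fin.succ) f) :=
  (mem_Vbi_inr_succ hf p 1 0 one_zero_ne_zero).mpr (eval_zero_of_isHomogeneous hd hf)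

end UGen

/-- If `X ∩ V(ℓ_x) ∩ V(ℓ_y) = ∅`, then
`X̃ ∩ V(ℓ_x, ℓ_y) = {([u : x], [1 : 𝟎]) : [x] ∈ π_x(X), ℓ_x(x) = 0} ∪
{([1 : 𝟎], [v : y]) : [y] ∈ π_y(X), ℓ_y(y) = 0} ∪ {([1 : 𝟎], [1 : 𝟎])}`. -/
theorem statement12 {m n : ℕ}
    (X : Set (Projectivization ℂ (Fin (m + 1) → ℂ) × Projectivization ℂ (Fin (n + 1) → ℂ)))
    (hXcl : IsClosed X)
    (ℓx : MvPolynomial (Fin (m + 1)) ℂ) (hℓx : ℓx.IsHomogeneous 1)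
    (ℓy : MvPolynomial (Fin (n + 1)) ℂ) (hℓy : ℓy.IsHomogeneous 1)
    (hslice : X ∩ UGen.Vbi (rename Sum.inl ℓx) ∩ UGen.Vbi (rename Sum.inr ℓy) = ∅) :
    UGen.doubleCone X ∩ UGen.Vbi (rename (Sum.inl ∘ Fin.succ) ℓx) ∩
        UGen.Vbi (rename (Sum.inr ∘ Fin.succ) ℓy) =
      { q | ∃ (u : ℂ) (x : Fin (m + 1) → ℂ) (hx : x ≠ 0),
          Projectivization.mk ℂ x hx ∈ Prod.fst '' X ∧ eval x ℓx = 0 ∧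
            q = (Projectivization.mk ℂ (Fin.cons u x) (UGen.cons_ne_zero u hx),
                 UGen.e0) } ∪
      { q | ∃ (v : ℂ) (y : Fin (n + 1) → ℂ) (hy : y ≠ 0),
          Projectivization.mk ℂ y hy ∈ Prod.snd '' X ∧ eval y ℓy = 0 ∧
            q = (UGen.e0,
                 Projectivization.mk ℂ (Fin.cons v y) (UGen.cons_ne_zero v hy)) } ∪
      {(UGen.e0, UGen.e0)} := by
  ext q
  constructor
  · rintro ⟨⟨((⟨u, v, x, y, hx, hy, hX, rfl⟩ | ⟨u, x, hx, hX, rfl⟩) | ⟨v, y, hy, hX, rfl⟩) | rfl,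
      h₁⟩, h₂⟩
    · rw [UGen.mem_Vbi_inl_succ hℓx] at h₁
      rw [UGen.mem_Vbi_inr_succ hℓy] at h₂
      exact (hslice.subset ⟨⟨hX, (UGen.mem_Vbi_inl hℓx x hx _).mpr h₁⟩,
        (UGen.mem_Vbi_inr hℓy _ y hy).mpr h₂⟩).elim
    · exact .inl (.inl ⟨u, x, hx, hX, (UGen.mem_Vbi_inl_succ hℓx _ _ _ _).mp h₁, rfl⟩)
    · exact .inl (.inr ⟨v, y, hy, hX, (UGen.mem_Vbi_inr_succ hℓy _ _ _ _).mp h₂, rfl⟩)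
    · exact .inr rfl
  · rintro ((⟨u, x, hx, hX, h, rfl⟩ | ⟨v, y, hy, hX, h, rfl⟩) | rfl)
    · exact ⟨⟨.inl (.inl (.inr ⟨u, x, hx, hX, rfl⟩)), (UGen.mem_Vbi_inl_succ hℓx _ _ _ _).mpr h⟩,
        UGen.e0_mem_Vbi_inr_succ one_ne_zero hℓy _⟩
    · exact ⟨⟨.inl (.inr ⟨v, y, hy, hX, rfl⟩), UGen.e0_mem_Vbi_inl_succ one_ne_zero hℓx _⟩,
        (UGen.mem_Vbi_inr_succ hℓy _ _ _ _).mpr h⟩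
    · exact ⟨⟨.inr rfl, UGen.e0_mem_Vbi_inl_succ one_ne_zero hℓx _⟩,
        UGen.e0_mem_Vbi_inr_succ one_ne_zero hℓy _⟩
end
end
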